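/- Consider the game in the closed left half-plane H = {(a,b) ∈ ℝ² : a ≤ 0} in which a single porter is restricted to the y-axis {(0,b) : b ∈ ℝ} and a student moves freely in H, both at speed at most 1, with the student starting at (−1,0) and the porter at (0,0); the student wins a play if at the first time he reaches the y-axis the porter is not at his position, and the porter wins otherwise (including if the student never reaches the y-axis). Then both the porter and the student have winning strategies in this game. -/

import Mathlib

/-!
A porter guarding the whole y-axis against a student in the closed left half-plane:
both the porter and the student have winning strategies.
-/

open NNReal

noncomputable section

abbrev E2 := EuclideanSpace ℝ (Fin 2)

/-- The point `(a, b)` of the Euclidean plane. -/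
def ptE (a b : ℝ) : E2 := (WithLp.equiv 2 (Fin 2 → ℝ)).symm ![a, b]

/-- The closed left half-plane. -/
def LeftHalfPlane : Set E2 := {p : E2 | p 0 ≤ 0}

/-- The y-axis. -/
def YAxis : Set E2 := {p : E2 | p 0 = 0}

/-- A student path: speed at most 1, starting at `(-1,0)`, staying in the closed left
half-plane. -/
def IsStudentPath (f : ℝ≥0 → E2) : Prop :=
  f 0 = ptE (-1) 0 ∧ LipschitzWith 1 f ∧ ∀ t, f t ∈ LeftHalfPlane

/-- A porter path: speed at most 1, starting at `(0,0)`, staying on the y-axis. -/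
def IsPorterPath (g : ℝ≥0 → E2) : Prop :=
  g 0 = ptE 0 0 ∧ LipschitzWith 1 g ∧ ∀ t, g t ∈ YAxis

/-- A porter strategy: a no-lookahead map from student paths to porter paths. -/
def IsPorterStrategy (Φ : (ℝ≥0 → E2) → (ℝ≥0 → E2)) : Prop :=
  (∀ s, IsStudentPath s → IsPorterPath (Φ s)) ∧
  ∀ s s', IsStudentPath s → IsStudentPath s' → ∀ t : ℝ≥0,
    (∀ u ≤ t, s u = s' u) → ∀ u ≤ t, Φ s u = Φ s' u

/-- A student strategy: a no-lookahead map from porter paths to student paths. -/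
def IsStudentStrategy (Ψ : (ℝ≥0 → E2) → (ℝ≥0 → E2)) : Prop :=
  (∀ g, IsPorterPath g → IsStudentPath (Ψ g)) ∧
  ∀ g g', IsPorterPath g → IsPorterPath g' → ∀ t : ℝ≥0,
    (∀ u ≤ t, g u = g' u) → ∀ u ≤ t, Ψ g u = Ψ g' u

/-- The student wins a play if at the first time he is on the y-axis the porter is not
at his position; otherwise (including if he never reaches the y-axis) the porter wins. -/
def StudentWinsPlay (s g : ℝ≥0 → E2) : Prop :=
  ∃ t : ℝ≥0, s t ∈ YAxis ∧ (∀ u, u < t → s u ∉ YAxis) ∧ g t ≠ s t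

@[simp] lemma ptE_zero (a b : ℝ) : ptE a b 0 = a := rfl

@[simp] lemma ptE_one (a b : ℝ) : ptE a b 1 = b := rfl

lemma dist_sq_E2 (p q : E2) : dist p q ^ 2 = (p 0 - q 0) ^ 2 + (p 1 - q 1) ^ 2 := by
  rw [EuclideanSpace.dist_eq, Real.sq_sqrt (by positivity)]
  simp [Fin.sum_univ_two, Real.dist_eq]

lemma abs_coord_one_sub_le_dist (p q : E2) : |p 1 - q 1| ≤ dist p q :=
  abs_le_of_sq_le_sq (by rw [dist_sq_E2]; nlinarith [sq_nonneg (p 0 - q 0)]) dist_nonneg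

lemma lipschitz_coord_one {f : ℝ≥0 → E2} (hf : LipschitzWith 1 f) (s t : ℝ≥0) :
    |f s 1 - f t 1| ≤ |(s : ℝ) - t| := by
  refine (abs_coord_one_sub_le_dist _ _).trans ?_
  simpa [NNReal.dist_eq] using hf.dist_le_mul s t

lemma lipschitzWith_one_of_sq_le {f : ℝ≥0 → E2}
    (h : ∀ s t : ℝ≥0, s ≤ t →
      (f s 0 - f t 0) ^ 2 + (f s 1 - f t 1) ^ 2 ≤ ((t : ℝ) - s) ^ 2) :
    LipschitzWith 1 f := by
  have key : ∀ s t : ℝ≥0, s ≤ t → dist (f s) (f t) ≤ dist s t := by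
    intro s t hst
    refine (sq_le_sq₀ dist_nonneg dist_nonneg).1 ?_
    rw [dist_sq_E2, NNReal.dist_eq, sq_abs]
    linarith [h s t hst, sub_sq_comm (s : ℝ) t]
  refine LipschitzWith.of_dist_le_mul fun s t => ?_
  rw [NNReal.coe_one, one_mul]
  rcases le_total s t with hst | hst
  · exact key s t hst
  · rw [dist_comm (f s), dist_comm s]
    exact key t s hst

/-- The porter strategy that stays at the student's height. -/
def projectionStrategy (s : ℝ≥0 → E2) : ℝ≥0 → E2 := fun t => ptE 0 (s t 1)

lemma isPorterStrategy_projectionStrategy : IsPorterStrategy projectionStrategy := by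
  refine ⟨fun s ⟨h0, hL, _⟩ => ⟨by simp [projectionStrategy, h0], ?_, fun t => ?_⟩, ?_⟩
  · refine lipschitzWith_one_of_sq_le fun a b _ => ?_
    have h := sq_le_sq.2 (lipschitz_coord_one hL a b)
    simp only [projectionStrategy, ptE_zero, ptE_one]
    linarith [sub_sq_comm (a : ℝ) b]
  · simp [projectionStrategy, YAxis]
  · intro s s' _ _ t h u hu
    simp [projectionStrategy, h u hu]

lemma not_studentWinsPlay_projectionStrategy (s : ℝ≥0 → E2) :
    ¬ StudentWinsPlay s (projectionStrategy s) := by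
  rintro ⟨t, ht, -, hne⟩
  apply hne
  ext i
  fin_cases i
  · exact (show s t 0 = 0 from ht).symm
  · rfl

/-- The path that runs vertically in direction `σ` until time `1`, and afterwards moves towards
the y-axis at horizontal speed `v` and vertical speed `1 - v ^ 2`, still in direction `σ`. -/
def escapePath (σ v : ℝ) : ℝ≥0 → E2 := fun t =>
  ptE (min 0 (-1 + v * max ((t : ℝ) - 1) 0))
    (σ * (min (t : ℝ) 1 + (1 - v ^ 2) * max ((t : ℝ) - 1) 0))

lemma isStudentPath_escapePath {σ v : ℝ} (hσ : σ ^ 2 = 1) (h0 : 0 ≤ v) (h1 : v ≤ 1) :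
    IsStudentPath (escapePath σ v) := by
  refine ⟨by simp [escapePath], lipschitzWith_one_of_sq_le fun s t hst => ?_,
    fun t => by simp [escapePath, LeftHalfPlane]⟩
  have hst' : (s : ℝ) ≤ t := hst
  simp only [escapePath, ptE_zero, ptE_one]
  have ha : min (s : ℝ) 1 ≤ min (t : ℝ) 1 := min_le_min_right _ hst'
  have hb : max ((s : ℝ) - 1) 0 ≤ max ((t : ℝ) - 1) 0 := max_le_max_right _ (by linarith)
  have hs : min (s : ℝ) 1 + max ((s : ℝ) - 1) 0 = s := by
    rcases le_total (s : ℝ) 1 with h | h <;> simp [h]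
  have ht : min (t : ℝ) 1 + max ((t : ℝ) - 1) 0 = t := by
    rcases le_total (t : ℝ) 1 with h | h <;> simp [h]
  generalize min (s : ℝ) 1 = a at *
  generalize min (t : ℝ) 1 = a' at *
  generalize max ((s : ℝ) - 1) 0 = b at *
  generalize max ((t : ℝ) - 1) 0 = b' at *
  obtain ⟨x, hx, rfl⟩ : ∃ x, 0 ≤ x ∧ a' = a + x := ⟨a' - a, by linarith, by ring⟩
  obtain ⟨y, hy, rfl⟩ : ∃ y, 0 ≤ y ∧ b' = b + y := ⟨b' - b, by linarith, by ring⟩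
  have hxy : (t : ℝ) - s = x + y := by linarith
  have hX : (min 0 (-1 + v * b) - min 0 (-1 + v * (b + y))) ^ 2 ≤ (v * y) ^ 2 := by
    refine sq_le_sq.2 ((abs_min_sub_min_le_max _ _ _ _).trans (max_le (by rw [sub_self, abs_zero]; positivity) ?_))
    rw [← abs_neg]
    exact (congrArg abs (by ring)).le
  have hY : (σ * (a + (1 - v ^ 2) * b) - σ * (a + x + (1 - v ^ 2) * (b + y))) ^ 2
      = (x + (1 - v ^ 2) * y) ^ 2 := by
    linear_combination (x + (1 - v ^ 2) * y) ^ 2 * hσ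
  rw [hY, hxy]
  have hv : v ^ 2 ≤ 1 := by nlinarith
  nlinarith [mul_nonneg (mul_nonneg hx hy) (sq_nonneg v),
    mul_nonneg (mul_nonneg (sq_nonneg v) (sub_nonneg.2 hv)) (sq_nonneg y)]

/-- If the porter's gap at time `1` exceeds the horizontal speed, the escape path wins. -/
lemma studentWinsPlay_escapePath {σ v : ℝ} {g : ℝ≥0 → E2} (hg : LipschitzWith 1 g)
    (hσ : σ ^ 2 = 1) (h0 : 0 < v) (hv : v < 1 - σ * g 1 1) :
    StudentWinsPlay (escapePath σ v) g := by
  have hT : (((1 + v⁻¹).toNNReal : ℝ≥0) : ℝ) = 1 + v⁻¹ := Real.coe_toNNReal _ (by positivity)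
  have hi : 0 < v⁻¹ := inv_pos.2 h0
  have hvi : v * v⁻¹ = 1 := mul_inv_cancel₀ h0.ne'
  refine ⟨(1 + v⁻¹).toNNReal, ?_, fun u hu => ?_, fun he => ?_⟩
  · simp [YAxis, escapePath, hi.le, hvi]
  · have hu' : (u : ℝ) < 1 + v⁻¹ := by rw [← hT]; exact_mod_cast hu
    have hm : max ((u : ℝ) - 1) 0 < v⁻¹ := max_lt (by linarith) hi
    have : v * max ((u : ℝ) - 1) 0 < 1 := by
      simpa only [hvi] using mul_lt_mul_of_pos_left hm h0
    have hlt : min 0 (-1 + v * max ((u : ℝ) - 1) 0) < 0 := min_lt_of_right_lt (by linarith)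
    exact hlt.ne
  · have hy : g (1 + v⁻¹).toNNReal 1 = σ * (1 + (1 - v ^ 2) * v⁻¹) := by
      rw [he]
      simp [escapePath, hi.le]
    have hL := lipschitz_coord_one hg (1 + v⁻¹).toNNReal 1
    rw [hT, hy, NNReal.coe_one, add_sub_cancel_left, abs_of_pos hi] at hL
    have h1 : (1 + (1 - v ^ 2) * v⁻¹) - σ * g 1 1 ≤ v⁻¹ := by
      rcases eq_or_eq_neg_of_sq_eq_sq σ 1 (by rw [hσ, one_pow]) with rfl | rfl
      · linarith [(abs_le.1 hL).2]
      · linarith [(abs_le.1 hL).1]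
    nlinarith [hvi]

/-- The porter initially moves up at full speed. -/
def StartsUpward (g : ℝ≥0 → E2) : Prop := ∃ ε : ℝ≥0, 0 < ε ∧ ∀ u ≤ ε, g u 1 = u

lemma StartsUpward.congr {g g' : ℝ≥0 → E2} {t : ℝ≥0} (ht : 0 < t) (h : ∀ u ≤ t, g u = g' u)
    (hg : StartsUpward g) : StartsUpward g' := by
  obtain ⟨ε, hε, H⟩ := hg
  refine ⟨min ε t, lt_min hε ht, fun u hu => ?_⟩
  rw [← h u (hu.trans (min_le_right _ _)), H u (hu.trans (min_le_left _ _))]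

open Classical in
/-- The vertical direction in which the student flees: away from a porter who starts upward at
full speed, and upward otherwise. -/
def escapeDirection (g : ℝ≥0 → E2) : ℝ := if StartsUpward g then -1 else 1

lemma escapeDirection_sq (g : ℝ≥0 → E2) : escapeDirection g ^ 2 = 1 := by
  unfold escapeDirection
  split_ifs <;> norm_num

lemma escapeDirection_congr {g g' : ℝ≥0 → E2} {t : ℝ≥0} (ht : 0 < t)
    (h : ∀ u ≤ t, g u = g' u) : escapeDirection g = escapeDirection g' := by
  have : StartsUpward g ↔ StartsUpward g' :=
    ⟨.congr ht h, .congr ht fun u hu => (h u hu).symm⟩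
  unfold escapeDirection
  congr 1
  exact propext this

lemma IsPorterPath.abs_coord_one_le {g : ℝ≥0 → E2} (hg : IsPorterPath g) (t : ℝ≥0) :
    |g t 1| ≤ t := by
  simpa [hg.1] using lipschitz_coord_one hg.2.1 t 0

lemma IsPorterPath.escapeDirection_mul_lt_one {g : ℝ≥0 → E2} (hg : IsPorterPath g) :
    escapeDirection g * g 1 1 < 1 := by
  unfold escapeDirection
  split_ifs with h
  · obtain ⟨ε, hε, H⟩ := h
    have hm : (0 : ℝ) < min ε 1 := by exact_mod_cast lt_min hε one_pos
    have hm1 : ((min ε 1 : ℝ≥0) : ℝ) ≤ 1 := by exact_mod_cast min_le_right ε 1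
    have hL := lipschitz_coord_one hg.2.1 (min ε 1) 1
    rw [H _ (min_le_left _ _), NNReal.coe_one, abs_of_nonpos (a := _ - (1 : ℝ)) (by linarith)] at hL
    push_cast at *
    linarith [(abs_le.1 hL).2]
  · rw [one_mul]
    by_contra! h1
    refine h ⟨1, one_pos, fun u hu => ?_⟩
    have hu' : (u : ℝ) ≤ 1 := hu
    have hL := lipschitz_coord_one hg.2.1 1 u
    rw [NNReal.coe_one, abs_of_nonneg (a := (1 : ℝ) - _) (by linarith)] at hL
    linarith [(abs_le.1 hL).2, (abs_le.1 (hg.abs_coord_one_le u)).2]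

/-- The student strategy that runs parallel to the y-axis for one unit of time, and then
approaches it slowly enough for the porter not to close the gap. -/
def escapeStrategy (g : ℝ≥0 → E2) : ℝ≥0 → E2 :=
  escapePath (escapeDirection g) ((1 - escapeDirection g * g 1 1) / 2)

lemma isStudentStrategy_escapeStrategy : IsStudentStrategy escapeStrategy := by
  refine ⟨fun g hg => isStudentPath_escapePath (escapeDirection_sq g)
    (by linarith [hg.escapeDirection_mul_lt_one]) ?_, ?_⟩
  · have h1 := hg.abs_coord_one_le 1
    have h2 : |escapeDirection g| = 1 := by
      rw [← sq_eq_sq₀ (abs_nonneg _) one_pos.le, sq_abs, escapeDirection_sq, one_pow]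
    have h3 : |escapeDirection g * g 1 1| ≤ 1 := by rw [abs_mul, h2, one_mul]; exact h1
    linarith [(abs_le.1 h3).1]
  · intro g g' _ _ t h u hu
    rcases eq_or_ne u 0 with rfl | hu0
    · simp [escapeStrategy, escapePath]
    have hσ := escapeDirection_congr ((pos_iff_ne_zero.2 hu0).trans_le hu) h
    rcases le_or_gt u 1 with hu1 | hu1
    · have : (u : ℝ) ≤ 1 := hu1
      simp [escapeStrategy, escapePath, hσ, this]
    · simp only [escapeStrategy, hσ, h 1 (hu1.le.trans hu)]

/-- In the game where a single porter guards the whole y-axis against a student in the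
closed left half-plane (student starting at `(-1,0)`, porter at `(0,0)`), both the
porter and the student have winning strategies. -/
theorem porter_and_student_both_win_on_halfplane :
    (∃ Φ, IsPorterStrategy Φ ∧
      ∀ s, IsStudentPath s → ¬ StudentWinsPlay s (Φ s)) ∧
    (∃ Ψ, IsStudentStrategy Ψ ∧
      ∀ g, IsPorterPath g → StudentWinsPlay (Ψ g) g) :=
  ⟨⟨projectionStrategy, isPorterStrategy_projectionStrategy,
      fun s _ => not_studentWinsPlay_projectionStrategy s⟩,
    ⟨escapeStrategy, isStudentStrategy_escapeStrategy, fun g hg => by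
      have h := hg.escapeDirection_mul_lt_one
      exact studentWinsPlay_escapePath hg.2.1 (escapeDirection_sq g)
        (by linarith) (by linarith)⟩⟩

end
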